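/- Let u ∈ H^{r,σ} and v ∈ H^{s,σ} be 2π-periodic functions with s > 1/2, s ≥ r ≥ 0, σ ≥ 0. Then there exists a constant C = C(r, s), independent of u, v and σ, such that ‖uv‖_{r,σ} ≤ C ‖u‖_{r,σ} ‖v‖_{s,σ}. -/

import Mathlib

noncomputable section

/-- `[k] = max {1, |k|}`. -/
def br (k : ℤ) : ℝ := max 1 |(k : ℝ)|

/-- weight `[k]^{2s} e^{2σ|k|}`. -/
def wt (s σ : ℝ) (k : ℤ) : ℝ := br k ^ (2*s) * Real.exp (2*σ*|(k : ℝ)|)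

/-- the weighted Sobolev norm `‖u‖_{s,σ}` of a 2π-periodic function, expressed through its
Fourier coefficients `u : ℤ → ℂ` (complex exponential basis). -/
def hnorm (s σ : ℝ) (u : ℤ → ℂ) : ℝ := Real.sqrt (∑' k : ℤ, wt s σ k * ‖u k‖^2)

/-- the Fourier coefficients of the product `uv` are the convolution of those of `u` and `v`. -/
def conv (u v : ℤ → ℂ) (j : ℤ) : ℂ := ∑' k : ℤ, u (j - k) * v k

lemma one_le_br (k : ℤ) : 1 ≤ br k := le_max_left _ _

lemma br_pos (k : ℤ) : 0 < br k := zero_lt_one.trans_le (one_le_br k)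

lemma wt_pos (s σ : ℝ) (k : ℤ) : 0 < wt s σ k :=
  mul_pos (Real.rpow_pos_of_pos (br_pos k) _) (Real.exp_pos _)

lemma br_add_le (a b : ℤ) : br (a + b) ≤ br a + br b := by
  refine max_le (by linarith [one_le_br a, one_le_br b]) ?_
  push_cast
  exact (abs_add_le _ _).trans (add_le_add (le_max_right _ _) (le_max_right _ _))

lemma summable_br_rpow {p : ℝ} (hp : 1 < p) : Summable fun k : ℤ => br k ^ (-p) := by
  refine (summable_congr_cofinite ?_).1 (Real.summable_abs_int_rpow hp)
  have h0 : ∀ᶠ k : ℤ in Filter.cofinite, k ≠ 0 :=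
    (Set.finite_singleton (0 : ℤ)).compl_mem_cofinite
  filter_upwards [h0] with k hk
  have h1 : (1 : ℝ) ≤ |(k : ℝ)| := by exact_mod_cast Int.one_le_abs hk
  rw [br, max_eq_right h1]

/-- Moderateness of the bracket weights: the larger of `br a`, `br b` absorbs
`br (a + b)`. -/
lemma br_add_rpow_le {r s : ℝ} (hr0 : 0 ≤ r) (hrs : r ≤ s) (a b : ℤ) :
    br (a + b) ^ (2 * r) ≤
      2 ^ (2 * r) * (br a ^ (2 * r) * br b ^ (2 * s) * (br b ^ (-(2 * s)) + br a ^ (-(2 * s)))) := by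
  have ha := br_pos a
  have hb := br_pos b
  have ea : br a ^ (2 * s) * br a ^ (-(2 * s)) = 1 := by
    rw [← Real.rpow_add ha, add_neg_cancel, Real.rpow_zero]
  have eb : br b ^ (2 * s) * br b ^ (-(2 * s)) = 1 := by
    rw [← Real.rpow_add hb, add_neg_cancel, Real.rpow_zero]
  have key : ∀ m, 0 < m → br (a + b) ≤ 2 * m →
      br (a + b) ^ (2 * r) ≤ 2 ^ (2 * r) * m ^ (2 * r) := fun m hm h => by
    rw [← Real.mul_rpow zero_le_two hm.le]
    exact Real.rpow_le_rpow (br_pos _).le h (by linarith)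
  have hadd := br_add_le a b
  have hpos : 0 ≤ br a ^ (2 * r) * br b ^ (2 * s) := by positivity
  rcases le_total (br b) (br a) with h | h
  · refine (key (br a) ha (by linarith)).trans ?_
    gcongr
    calc br a ^ (2 * r) = br a ^ (2 * r) * br b ^ (2 * s) * br b ^ (-(2 * s)) := by
          rw [mul_assoc, eb, mul_one]
      _ ≤ _ := by gcongr; exact le_add_of_nonneg_right (by positivity)
  · refine (key (br b) hb (by linarith)).trans ?_
    gcongr
    have hmono : br a ^ (2 * s - 2 * r) ≤ br b ^ (2 * s - 2 * r) :=
      Real.rpow_le_rpow ha.le h (by linarith)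
    have e1 : br b ^ (2 * s) = br b ^ (2 * r) * br b ^ (2 * s - 2 * r) := by
      rw [← Real.rpow_add hb]; congr 1; ring
    have e2 : br a ^ (2 * s) = br a ^ (2 * r) * br a ^ (2 * s - 2 * r) := by
      rw [← Real.rpow_add ha]; congr 1; ring
    calc br b ^ (2 * r)
        = br b ^ (2 * r) * (br a ^ (2 * r) * br a ^ (2 * s - 2 * r) * br a ^ (-(2 * s))) := by
          rw [← e2, ea, mul_one]
      _ ≤ br b ^ (2 * r) * (br a ^ (2 * r) * br b ^ (2 * s - 2 * r) * br a ^ (-(2 * s))) := by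
          gcongr
      _ = br a ^ (2 * r) * br b ^ (2 * s) * br a ^ (-(2 * s)) := by rw [e1]; ring
      _ ≤ _ := by gcongr; exact le_add_of_nonneg_left (by positivity)

lemma wt_add_le {r s σ : ℝ} (hr0 : 0 ≤ r) (hrs : r ≤ s) (hσ : 0 ≤ σ) (a b : ℤ) :
    wt r σ (a + b) ≤
      2 ^ (2 * r) * (br b ^ (-(2 * s)) + br a ^ (-(2 * s))) * (wt r σ a * wt s σ b) := by
  have hexp : Real.exp (2 * σ * |((a + b : ℤ) : ℝ)|) ≤
      Real.exp (2 * σ * |(a : ℝ)|) * Real.exp (2 * σ * |(b : ℝ)|) := by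
    rw [← Real.exp_add, ← mul_add]
    push_cast
    gcongr
    exact abs_add_le _ _
  have ha := br_pos a
  have hb := br_pos b
  calc wt r σ (a + b) ≤ _ :=
        mul_le_mul (br_add_rpow_le hr0 hrs a b) hexp (Real.exp_pos _).le (by positivity)
    _ = _ := by simp only [wt]; ring

/-- Cauchy–Schwarz for series, with no summability assumption on `f`. -/
lemma norm_tsum_sq_le {ι : Type*} {f : ι → ℂ} {h p : ι → ℝ} (h0 : ∀ i, 0 ≤ h i)
    (p0 : ∀ i, 0 ≤ p i) (hh : Summable h) (hp : Summable p)
    (hf : ∀ i, ‖f i‖ ^ 2 ≤ h i * p i) : ‖∑' i, f i‖ ^ 2 ≤ (∑' i, h i) * ∑' i, p i := by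
  have sq {x : ℝ} (hx : 0 ≤ x) : √x ^ (2 : ℝ) = x := by
    rw [Real.rpow_two, Real.sq_sqrt hx]
  obtain ⟨hs, hle⟩ := Real.summable_and_inner_le_Lp_mul_Lq_tsum_of_nonneg
    (p := 2) (q := 2) (f := fun i => √(h i)) (g := fun i => √(p i)) Real.HolderConjugate.two_two
    (fun i => Real.sqrt_nonneg _) (fun i => Real.sqrt_nonneg _)
    (by simpa only [sq (h0 _)] using hh) (by simpa only [sq (p0 _)] using hp)
  simp only [sq (h0 _), sq (p0 _), ← Real.sqrt_eq_rpow] at hle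
  have hb : ‖∑' i, f i‖ ≤ ∑' i, √(h i) * √(p i) := by
    refine tsum_of_norm_bounded hs.hasSum fun i => ?_
    rw [← Real.sqrt_mul (h0 i)]
    exact Real.le_sqrt_of_sq_le (hf i)
  calc ‖∑' i, f i‖ ^ 2 ≤ (√(∑' i, h i) * √(∑' i, p i)) ^ 2 := by
        gcongr; exact hb.trans hle
    _ = _ := by rw [mul_pow, Real.sq_sqrt (tsum_nonneg h0), Real.sq_sqrt (tsum_nonneg p0)]

lemma hasSum_tsum_convolution {U V : ℤ → ℝ} (hU : Summable U) (hV : Summable V)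
    (hU0 : ∀ k, 0 ≤ U k) (hV0 : ∀ k, 0 ≤ V k) :
    (∀ j, Summable fun k => U (j - k) * V k) ∧
      HasSum (fun j => ∑' k, U (j - k) * V k) ((∑' k, U k) * ∑' k, V k) := by
  let e : ℤ × ℤ ≃ ℤ × ℤ :=
    { toFun := fun x => (x.1 - x.2, x.2)
      invFun := fun x => (x.1 + x.2, x.2)
      left_inv := fun x => by simp
      right_inv := fun x => by simp }
  have hP : Summable fun x : ℤ × ℤ => U x.1 * V x.2 := hU.mul_of_nonneg hV hU0 hV0
  have hS := e.hasSum_iff.2 (hU.hasSum.mul hV.hasSum hP)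
  have hj : ∀ j, Summable fun k => U (j - k) * V k := fun j => hS.summable.prod_factor j
  exact ⟨hj, hS.prod_fiberwise fun j => (hj j).hasSum⟩

lemma wt_mul_norm_conv_sq_le {r s σ : ℝ} (hs : 1 / 2 < s) (hr0 : 0 ≤ r) (hrs : r ≤ s)
    (hσ : 0 ≤ σ) (u v : ℤ → ℂ) (j : ℤ)
    (hP : Summable fun k => wt r σ (j - k) * ‖u (j - k)‖ ^ 2 * (wt s σ k * ‖v k‖ ^ 2)) :
    wt r σ j * ‖conv u v j‖ ^ 2 ≤ 2 ^ (2 * r) * (2 * ∑' k, br k ^ (-(2 * s))) *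
      ∑' k, wt r σ (j - k) * ‖u (j - k)‖ ^ 2 * (wt s σ k * ‖v k‖ ^ 2) := by
  have hg : Summable fun k : ℤ => br k ^ (-(2 * s)) := summable_br_rpow (by linarith)
  have hg' : Summable fun k : ℤ => br (j - k) ^ (-(2 * s)) := (Equiv.subLeft j).summable_iff.2 hg
  have hgsum : ∑' k, (br k ^ (-(2 * s)) + br (j - k) ^ (-(2 * s))) =
      2 * ∑' k, br k ^ (-(2 * s)) := by
    have hrefl : ∑' k, br (j - k) ^ (-(2 * s)) = ∑' k, br k ^ (-(2 * s)) :=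
      (Equiv.subLeft j).tsum_eq fun k => br k ^ (-(2 * s))
    rw [hg.tsum_add hg', hrefl, ← two_mul]
  have hw := wt_pos r σ j
  have hb := br_pos
  have hCS := norm_tsum_sq_le (f := fun k => u (j - k) * v k)
    (h := fun k => 2 ^ (2 * r) / wt r σ j * (br k ^ (-(2 * s)) + br (j - k) ^ (-(2 * s))))
    (fun k => by have := hb k; have := hb (j - k); positivity)
    (fun k => by have := wt_pos r σ (j - k); have := wt_pos s σ k; positivity)
    ((hg.add hg').mul_left _) hP (fun k => by
      have h := wt_add_le hr0 hrs hσ (j - k) k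
      rw [sub_add_cancel] at h
      rw [norm_mul, mul_pow, div_mul_eq_mul_div, div_mul_eq_mul_div, le_div_iff₀ hw]
      refine (mul_le_mul_of_nonneg_left h (by positivity)).trans_eq ?_
      ring)
  rw [tsum_mul_left, hgsum] at hCS
  refine (mul_le_mul_of_nonneg_left hCS hw.le).trans_eq ?_
  rw [← mul_assoc, ← mul_assoc, mul_div_cancel₀ _ hw.ne']

/-- if `u ∈ H^{r,σ}`, `v ∈ H^{s,σ}` with `s > 1/2`, `s ≥ r ≥ 0`, `σ ≥ 0`, then
`‖uv‖_{r,σ} ≤ C ‖u‖_{r,σ} ‖v‖_{s,σ}` with a constant `C = C(r,s)` independent of `u`, `v`, `σ`. -/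
theorem product_estimate (r s : ℝ) (hs : 1/2 < s) (hr0 : 0 ≤ r) (hrs : r ≤ s) :
    ∃ C : ℝ, 0 < C ∧ ∀ σ : ℝ, 0 ≤ σ → ∀ u v : ℤ → ℂ,
      Summable (fun k : ℤ => wt r σ k * ‖u k‖^2) →
      Summable (fun k : ℤ => wt s σ k * ‖v k‖^2) →
      hnorm r σ (conv u v) ≤ C * hnorm r σ u * hnorm s σ v := by
  have hg0 : ∀ k : ℤ, 0 ≤ br k ^ (-(2 * s)) := fun k => Real.rpow_nonneg (br_pos k).le _
  have hG : 0 < ∑' k : ℤ, br k ^ (-(2 * s)) :=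
    (summable_br_rpow (by linarith)).tsum_pos hg0 0 (Real.rpow_pos_of_pos (br_pos 0) _)
  set D : ℝ := 2 ^ (2 * r) * (2 * ∑' k : ℤ, br k ^ (-(2 * s))) with hD
  have hD0 : 0 < D := by positivity
  refine ⟨√D, Real.sqrt_pos.2 hD0, fun σ hσ u v hu hv => ?_⟩
  have hU0 : ∀ k, 0 ≤ wt r σ k * ‖u k‖ ^ 2 := fun k => mul_nonneg (wt_pos _ _ _).le (sq_nonneg _)
  have hV0 : ∀ k, 0 ≤ wt s σ k * ‖v k‖ ^ 2 := fun k => mul_nonneg (wt_pos _ _ _).le (sq_nonneg _)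
  obtain ⟨hj, hsum⟩ := hasSum_tsum_convolution hu hv hU0 hV0
  have hle := fun j => wt_mul_norm_conv_sq_le hs hr0 hrs hσ u v j (hj j)
  have hDsum := hsum.mul_left D
  have hconv : Summable fun j => wt r σ j * ‖conv u v j‖ ^ 2 :=
    hDsum.summable.of_nonneg_of_le
      (fun j => mul_nonneg (wt_pos _ _ _).le (sq_nonneg _)) hle
  have hmain := hasSum_le hle hconv.hasSum hDsum
  simp only [hnorm]
  rw [mul_assoc, ← Real.sqrt_mul (tsum_nonneg hU0), ← Real.sqrt_mul hD0.le]
  exact Real.sqrt_le_sqrt hmain
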